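/- Assume λ > 0, or λ = 0 and δ ≥ 1, and let (τ*, β*) be the unique saddle point of max_{β ≥ 0} min_{τ > 0} φ(τ, β; ρ, A). For τ > 0, β > 0 set α = 1/τ + 2λ/β and let X_{τ,β}(H) = max(−A, min(A, H/α)) for H a standard Gaussian. Then (τ*, β*) is the unique pair with τ > 0 and β > 0 solving the system τ²δ = ρ + E[X_{τ,β}(H)²] and β = 2τδ − 2E[H · X_{τ,β}(H)]; moreover φ(τ*, β*; ρ, A) = (β*)²/4 + λ·E[X_{τ*,β*}(H)²]. -/

import Mathlib

open MeasureTheory ProbabilityTheory Real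

/-- The deterministic scalar function
`φ(τ, β; ρ, A) = τβδ/2 + ρβ/(2τ) − β²/4 + E_H[min_{|x| ≤ A} ((β/(2τ)) x² + λ x² − β H x)]`,
where `H` is standard Gaussian. -/
noncomputable def phiFn (δ lam ρ A τ β : ℝ) : ℝ :=
  τ * β * δ / 2 + ρ * β / (2 * τ) - β ^ 2 / 4 +
    ∫ h : ℝ,
      sInf ((fun x : ℝ => β / (2 * τ) * x ^ 2 + lam * x ^ 2 - β * h * x) '' Set.Icc (-A) A)
      ∂(gaussianReal 0 1)

/-- `(τs, βs)` is a saddle point of `max_{β ≥ 0} min_{τ > 0} φ(τ, β; ρ, A)` with `τs > 0`,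
`βs > 0`. -/
def IsSaddle (δ lam ρ A τs βs : ℝ) : Prop :=
  0 < τs ∧ 0 < βs ∧
    (∀ τ : ℝ, 0 < τ → phiFn δ lam ρ A τs βs ≤ phiFn δ lam ρ A τ βs) ∧
    (∀ β : ℝ, 0 ≤ β → phiFn δ lam ρ A τs β ≤ phiFn δ lam ρ A τs βs)

/-- `X_{τ,β}(h) = max(−A, min(A, h/α))` with `α = 1/τ + 2λ/β`. -/
noncomputable def Xval (lam A τ β h : ℝ) : ℝ :=
  max (-A) (min A (h / (1 / τ + 2 * lam / β)))

open Filter Topology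

lemma Xval_mem {A : ℝ} (hA : 0 < A) (lam τ β h : ℝ) : Xval lam A τ β h ∈ Set.Icc (-A) A := by
  unfold Xval
  exact ⟨le_max_left _ _, max_le (by linarith) (min_le_left _ _)⟩

lemma measurable_Xval (lam A τ β : ℝ) : Measurable (Xval lam A τ β) := by
  unfold Xval
  fun_prop

/-- Variational inequality characterising the projection of `h / a` onto `[-A, A]`. -/
lemma clamp_variational {A a h x : ℝ} (hA : 0 < A) (ha : 0 < a) (hx : x ∈ Set.Icc (-A) A) :
    0 ≤ (a * max (-A) (min A (h / a)) - h) * (x - max (-A) (min A (h / a))) := by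
  obtain ⟨h1, h2⟩ := hx
  rcases le_total A (h / a) with h3 | h3
  · rw [min_eq_left h3, max_eq_right (by linarith)]
    rw [le_div_iff₀ ha] at h3
    nlinarith
  · rw [min_eq_right h3]
    rcases le_total (-A) (h / a) with h4 | h4
    · rw [max_eq_right h4, mul_div_cancel₀ _ ha.ne']
      simp
    · rw [max_eq_left h4]
      rw [div_le_iff₀ ha] at h4
      exact mul_nonneg (by linarith) (by linarith)

lemma Xval_variational {lam A τ β h x : ℝ} (hlam : 0 ≤ lam) (hA : 0 < A) (hτ : 0 < τ)
    (hβ : 0 < β) (hx : x ∈ Set.Icc (-A) A) :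
    0 ≤ ((β / τ + 2 * lam) * Xval lam A τ β h - β * h) * (x - Xval lam A τ β h) := by
  have ha : 0 < 1 / τ + 2 * lam / β := by positivity
  have key := mul_nonneg hβ.le (clamp_variational (h := h) hA ha hx)
  have e : β / τ + 2 * lam = β * (1 / τ + 2 * lam / β) := by field_simp
  rw [e]
  unfold Xval
  linarith

/-- Joint convexity in `(τ, x)` of the scalar objective, at the constrained minimiser. -/
lemma objective_tangent_le {lam A τ τ₀ β h x : ℝ} (hlam : 0 ≤ lam) (hA : 0 < A) (hτ : 0 < τ)
    (hτ₀ : 0 < τ₀) (hβ : 0 < β) (hx : x ∈ Set.Icc (-A) A) :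
    β / (2 * τ₀) * Xval lam A τ₀ β h ^ 2 + lam * Xval lam A τ₀ β h ^ 2
        - β * h * Xval lam A τ₀ β h
        - β * (τ - τ₀) / (2 * τ₀ ^ 2) * Xval lam A τ₀ β h ^ 2
      ≤ β / (2 * τ) * x ^ 2 + lam * x ^ 2 - β * h * x := by
  have key := Xval_variational (h := h) hlam hA hτ₀ hβ hx
  set y := Xval lam A τ₀ β h
  have h1 : 0 ≤ β / (2 * τ) * (x - τ / τ₀ * y) ^ 2 := by positivity
  have h2 : 0 ≤ lam * (x - y) ^ 2 := by positivity
  have e : β / (2 * τ) * x ^ 2 + lam * x ^ 2 - β * h * x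
      - (β / (2 * τ₀) * y ^ 2 + lam * y ^ 2 - β * h * y - β * (τ - τ₀) / (2 * τ₀ ^ 2) * y ^ 2)
      = ((β / τ₀ + 2 * lam) * y - β * h) * (x - y) + β / (2 * τ) * (x - τ / τ₀ * y) ^ 2
        + lam * (x - y) ^ 2 := by
    field_simp
    ring
  linarith

lemma bddBelow_objective (lam A τ β h : ℝ) :
    BddBelow ((fun x : ℝ => β / (2 * τ) * x ^ 2 + lam * x ^ 2 - β * h * x) '' Set.Icc (-A) A) :=
  (isCompact_Icc.image (by fun_prop)).bddBelow

lemma sInf_objective {lam A τ β : ℝ} (h : ℝ) (hlam : 0 ≤ lam) (hA : 0 < A) (hτ : 0 < τ)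
    (hβ : 0 < β) :
    sInf ((fun x : ℝ => β / (2 * τ) * x ^ 2 + lam * x ^ 2 - β * h * x) '' Set.Icc (-A) A)
      = (β / (2 * τ) + lam) * Xval lam A τ β h ^ 2 - β * (h * Xval lam A τ β h) := by
  have : IsLeast ((fun x : ℝ => β / (2 * τ) * x ^ 2 + lam * x ^ 2 - β * h * x) '' Set.Icc (-A) A)
      ((β / (2 * τ) + lam) * Xval lam A τ β h ^ 2 - β * (h * Xval lam A τ β h)) := by
    refine ⟨⟨Xval lam A τ β h, Xval_mem hA _ _ _ _, by ring⟩, ?_⟩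
    rintro _ ⟨x, hx, rfl⟩
    have := objective_tangent_le (h := h) hlam hA hτ hτ hβ hx
    rw [sub_self, mul_zero, zero_div, zero_mul] at this
    simp only
    linarith
  exact this.csInf_eq

lemma integrable_Xval_sq {A : ℝ} (hA : 0 < A) (lam τ β : ℝ) :
    Integrable (fun h => Xval lam A τ β h ^ 2) (gaussianReal 0 1) := by
  refine Integrable.of_bound ((measurable_Xval lam A τ β).pow_const 2).aestronglyMeasurable
    (A ^ 2) (Eventually.of_forall fun h => ?_)
  rw [norm_pow, Real.norm_eq_abs]
  have := abs_le.2 (Xval_mem hA lam τ β h)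
  gcongr

lemma integrable_id_gaussianReal : Integrable (fun h : ℝ => h) (gaussianReal 0 1) :=
  (memLp_id_gaussianReal (μ := 0) (v := 1) 1).integrable le_rfl

lemma norm_mul_Xval_le {A : ℝ} (hA : 0 < A) (lam τ β h : ℝ) :
    ‖h * Xval lam A τ β h‖ ≤ |h| * A := by
  rw [norm_mul, Real.norm_eq_abs, Real.norm_eq_abs]
  have := abs_le.2 (Xval_mem hA lam τ β h)
  gcongr

lemma integrable_mul_Xval {A : ℝ} (hA : 0 < A) (lam τ β : ℝ) :
    Integrable (fun h => h * Xval lam A τ β h) (gaussianReal 0 1) :=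
  (integrable_id_gaussianReal.abs.mul_const A).mono'
    (measurable_id.mul (measurable_Xval lam A τ β)).aestronglyMeasurable
    (Eventually.of_forall (norm_mul_Xval_le hA lam τ β))

lemma integral_objective {A : ℝ} (hA : 0 < A) (lam τ β a b : ℝ) :
    ∫ h, (a * Xval lam A τ β h ^ 2 - b * (h * Xval lam A τ β h)) ∂(gaussianReal 0 1)
      = a * ∫ h, Xval lam A τ β h ^ 2 ∂(gaussianReal 0 1)
        - b * ∫ h, h * Xval lam A τ β h ∂(gaussianReal 0 1) := by
  rw [integral_sub ((integrable_Xval_sq hA lam τ β).const_mul a)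
    ((integrable_mul_Xval hA lam τ β).const_mul b), integral_const_mul, integral_const_mul]

lemma integrable_objective {A : ℝ} (hA : 0 < A) (lam τ β a b : ℝ) :
    Integrable (fun h => a * Xval lam A τ β h ^ 2 - b * (h * Xval lam A τ β h))
      (gaussianReal 0 1) :=
  ((integrable_Xval_sq hA lam τ β).const_mul a).sub ((integrable_mul_Xval hA lam τ β).const_mul b)

lemma integrable_sInf_objective {lam A τ β : ℝ} (hlam : 0 ≤ lam) (hA : 0 < A) (hτ : 0 < τ)
    (hβ : 0 ≤ β) :
    Integrable (fun h : ℝ =>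
      sInf ((fun x : ℝ => β / (2 * τ) * x ^ 2 + lam * x ^ 2 - β * h * x) '' Set.Icc (-A) A))
      (gaussianReal 0 1) := by
  rcases hβ.eq_or_lt with rfl | hβ
  · simp only [zero_mul]
    exact integrable_const _
  · simp only [fun h => sInf_objective (β := β) h hlam hA hτ hβ]
    exact integrable_objective hA _ _ _ _ _

lemma phiFn_eq {lam A τ β : ℝ} (δ ρ : ℝ) (hlam : 0 ≤ lam) (hA : 0 < A) (hτ : 0 < τ)
    (hβ : 0 < β) :
    phiFn δ lam ρ A τ β = τ * β * δ / 2 + ρ * β / (2 * τ) - β ^ 2 / 4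
      + ((β / (2 * τ) + lam) * ∫ h, Xval lam A τ β h ^ 2 ∂(gaussianReal 0 1)
        - β * ∫ h, h * Xval lam A τ β h ∂(gaussianReal 0 1)) := by
  unfold phiFn
  simp only [fun h => sInf_objective (β := β) h hlam hA hτ hβ]
  rw [integral_objective hA]

/-- Any admissible choice `Xval lam A τ' β'` gives an upper bound for `phiFn`. -/
lemma phiFn_le {lam A τ β : ℝ} (δ ρ τ' β' : ℝ) (hlam : 0 ≤ lam) (hA : 0 < A) (hτ : 0 < τ)
    (hβ : 0 ≤ β) :
    phiFn δ lam ρ A τ β ≤ τ * β * δ / 2 + ρ * β / (2 * τ) - β ^ 2 / 4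
      + ((β / (2 * τ) + lam) * ∫ h, Xval lam A τ' β' h ^ 2 ∂(gaussianReal 0 1)
        - β * ∫ h, h * Xval lam A τ' β' h ∂(gaussianReal 0 1)) := by
  unfold phiFn
  rw [← integral_objective hA]
  refine add_le_add le_rfl ?_
  refine integral_mono (integrable_sInf_objective hlam hA hτ hβ)
    (integrable_objective hA _ _ _ _ _) fun h => ?_
  exact csInf_le (bddBelow_objective lam A τ β h)
    ⟨Xval lam A τ' β' h, Xval_mem hA _ _ _ _, by ring⟩

/-- Tangent lower bound for the convex part of `phiFn` in the variable `τ`. -/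
lemma le_phiFn {lam A τ τ₀ β : ℝ} (δ ρ : ℝ) (hlam : 0 ≤ lam) (hA : 0 < A) (hτ : 0 < τ)
    (hτ₀ : 0 < τ₀) (hβ : 0 < β) :
    τ * β * δ / 2 + ρ * β / (2 * τ) - β ^ 2 / 4
      + ((β / (2 * τ₀) + lam - β * (τ - τ₀) / (2 * τ₀ ^ 2))
          * ∫ h, Xval lam A τ₀ β h ^ 2 ∂(gaussianReal 0 1)
        - β * ∫ h, h * Xval lam A τ₀ β h ∂(gaussianReal 0 1)) ≤ phiFn δ lam ρ A τ β := by
  unfold phiFn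
  rw [← integral_objective hA]
  refine add_le_add le_rfl ?_
  refine integral_mono (integrable_objective hA _ _ _ _ _)
    (integrable_sInf_objective hlam hA hτ hβ.le) fun h => ?_
  refine le_csInf ((Set.nonempty_Icc.2 (by linarith)).image _) ?_
  rintro _ ⟨x, hx, rfl⟩
  have := objective_tangent_le (h := h) hlam hA hτ hτ₀ hβ hx
  simp only
  linarith

lemma continuousAt_Xval {lam A τ β : ℝ} (h : ℝ) (hlam : 0 ≤ lam) (hτ : 0 < τ) (hβ : 0 < β) :
    ContinuousAt (fun b => Xval lam A τ b h) β := by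
  have ha : 1 / τ + 2 * lam / β ≠ 0 := by positivity
  unfold Xval
  fun_prop (disch := first | exact ha | exact hβ.ne')

lemma continuousAt_integral_Xval_sq {lam A τ β : ℝ} (hlam : 0 ≤ lam) (hA : 0 < A) (hτ : 0 < τ)
    (hβ : 0 < β) :
    ContinuousAt (fun b => ∫ h, Xval lam A τ b h ^ 2 ∂(gaussianReal 0 1)) β := by
  refine continuousAt_of_dominated (bound := fun _ => A ^ 2)
    (Eventually.of_forall fun b => (integrable_Xval_sq hA lam τ b).aestronglyMeasurable)
    (Eventually.of_forall fun b => Eventually.of_forall fun h => ?_) (integrable_const _)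
    (Eventually.of_forall fun h => (continuousAt_Xval h hlam hτ hβ).pow 2)
  rw [norm_pow, Real.norm_eq_abs]
  have := abs_le.2 (Xval_mem hA lam τ b h)
  gcongr

lemma continuousAt_integral_mul_Xval {lam A τ β : ℝ} (hlam : 0 ≤ lam) (hA : 0 < A) (hτ : 0 < τ)
    (hβ : 0 < β) :
    ContinuousAt (fun b => ∫ h, h * Xval lam A τ b h ∂(gaussianReal 0 1)) β :=
  continuousAt_of_dominated (bound := fun h => |h| * A)
    (Eventually.of_forall fun b => (integrable_mul_Xval hA lam τ b).aestronglyMeasurable)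
    (Eventually.of_forall fun b => Eventually.of_forall (norm_mul_Xval_le hA lam τ b))
    (integrable_id_gaussianReal.abs.mul_const A)
    (Eventually.of_forall fun h => continuousAt_const.mul (continuousAt_Xval h hlam hτ hβ))

/-- First-order condition in `τ` at a saddle point. -/
lemma IsSaddle.tau_eq {δ lam ρ A τ β : ℝ} (hδ : 0 < δ) (hlam : 0 ≤ lam) (hρ : 0 < ρ)
    (hA : 0 < A) (hs : IsSaddle δ lam ρ A τ β) :
    τ ^ 2 * δ = ρ + ∫ h, Xval lam A τ β h ^ 2 ∂(gaussianReal 0 1) := by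
  obtain ⟨hτ, hβ, hmin, -⟩ := hs
  have hS : 0 ≤ ∫ h, Xval lam A τ β h ^ 2 ∂(gaussianReal 0 1) :=
    integral_nonneg fun h => sq_nonneg _
  have key := fun t ht => (phiFn_eq δ ρ hlam hA hτ hβ).symm.trans_le
    ((hmin t ht).trans (phiFn_le δ ρ τ β hlam hA ht hβ.le))
  set S := ∫ h, Xval lam A τ β h ^ 2 ∂(gaussianReal 0 1)
  set P := ∫ h, h * Xval lam A τ β h ∂(gaussianReal 0 1)
  have ht : 0 < √((ρ + S) / δ) := by positivity
  have hsq : √((ρ + S) / δ) ^ 2 * δ = ρ + S := by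
    rw [Real.sq_sqrt (by positivity)]
    field_simp
  have hk := key _ ht
  set t := √((ρ + S) / δ)
  have e : τ * β * δ / 2 + ρ * β / (2 * τ) - β ^ 2 / 4 + ((β / (2 * τ) + lam) * S - β * P)
      - (t * β * δ / 2 + ρ * β / (2 * t) - β ^ 2 / 4 + ((β / (2 * t) + lam) * S - β * P))
      = β * δ / (2 * τ) * (τ - t) ^ 2 := by
    rw [← sub_eq_zero] at hsq
    have hS' : S = t ^ 2 * δ - ρ := by linarith
    rw [hS']
    field_simp
    ring
  have h0 : (τ - t) ^ 2 = 0 := by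
    have hc : 0 < β * δ / (2 * τ) := by positivity
    nlinarith [sq_nonneg (τ - t)]
  have : τ = t := by linarith [pow_eq_zero_iff (two_ne_zero) |>.1 h0]
  rw [this, hsq]

/-- First-order condition in `β` at a saddle point. -/
lemma IsSaddle.deriv_beta_eq_zero {δ lam ρ A τ β : ℝ} (hlam : 0 ≤ lam) (hA : 0 < A)
    (hs : IsSaddle δ lam ρ A τ β) :
    τ * δ / 2 + ρ / (2 * τ) - (β + β) / 4
      + ((∫ h, Xval lam A τ β h ^ 2 ∂(gaussianReal 0 1)) / (2 * τ)
        - ∫ h, h * Xval lam A τ β h ∂(gaussianReal 0 1)) = 0 := by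
  obtain ⟨hτ, hβ, -, hmax⟩ := hs
  set G : ℝ → ℝ := fun b => τ * δ / 2 + ρ / (2 * τ) - (b + β) / 4
      + ((∫ h, Xval lam A τ b h ^ 2 ∂(gaussianReal 0 1)) / (2 * τ)
        - ∫ h, h * Xval lam A τ b h ∂(gaussianReal 0 1)) with hG
  have hcont : ContinuousAt G β :=
    (by fun_prop : ContinuousAt (fun b => τ * δ / 2 + ρ / (2 * τ) - (b + β) / 4) β).add
      (((continuousAt_integral_Xval_sq hlam hA hτ hβ).div_const _).sub
        (continuousAt_integral_mul_Xval hlam hA hτ hβ))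
  have key : ∀ b, 0 < b → (b - β) * G b ≤ 0 := by
    intro b hb
    have h1 := hmax b hb.le
    rw [phiFn_eq δ ρ hlam hA hτ hb] at h1
    have h2 := h1.trans (phiFn_le δ ρ τ b hlam hA hτ hβ.le)
    simp only [hG]
    rw [← sub_nonpos] at h2
    refine le_of_eq_of_le ?_ h2
    ring
  have hle : G β ≤ 0 := by
    refine le_of_tendsto (hcont.tendsto.mono_left nhdsWithin_le_nhds : Tendsto G (𝓝[>] β) _) ?_
    filter_upwards [self_mem_nhdsWithin] with b (hb : β < b)
    exact nonpos_of_mul_nonpos_right (key b (hβ.trans hb)) (sub_pos.2 hb)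
  have hge : 0 ≤ G β := by
    refine ge_of_tendsto (hcont.tendsto.mono_left nhdsWithin_le_nhds : Tendsto G (𝓝[<] β) _) ?_
    filter_upwards [self_mem_nhdsWithin, mem_nhdsWithin_of_mem_nhds (lt_mem_nhds hβ)]
      with b (hb : b < β) hb0
    exact nonneg_of_mul_nonpos_right (key b hb0) (sub_neg.2 hb)
  exact le_antisymm hle hge

lemma IsSaddle.beta_eq {δ lam ρ A τ β : ℝ} (hδ : 0 < δ) (hlam : 0 ≤ lam) (hρ : 0 < ρ)
    (hA : 0 < A) (hs : IsSaddle δ lam ρ A τ β) :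
    β = 2 * τ * δ - 2 * ∫ h, h * Xval lam A τ β h ∂(gaussianReal 0 1) := by
  have h1 := hs.tau_eq hδ hlam hρ hA
  have h2 := hs.deriv_beta_eq_zero hlam hA
  have hτ := hs.1
  have hS := eq_sub_of_add_eq' h1.symm
  rw [hS] at h2
  field_simp at h2
  nlinarith

/-- The first-order conditions are sufficient for a saddle point. -/
lemma isSaddle_of_system {δ lam ρ A τ β : ℝ} (hlam : 0 ≤ lam) (hρ : 0 < ρ)
    (hA : 0 < A) (hτ : 0 < τ) (hβ : 0 < β)
    (h1 : τ ^ 2 * δ = ρ + ∫ h, Xval lam A τ β h ^ 2 ∂(gaussianReal 0 1))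
    (h2 : β = 2 * τ * δ - 2 * ∫ h, h * Xval lam A τ β h ∂(gaussianReal 0 1)) :
    IsSaddle δ lam ρ A τ β := by
  have hS := eq_sub_of_add_eq' h1.symm
  refine ⟨hτ, hβ, fun t ht => ?_, fun b hb => ?_⟩
  · refine le_trans ?_ (le_phiFn δ ρ hlam hA ht hτ hβ)
    rw [phiFn_eq δ ρ hlam hA hτ hβ, hS, ← sub_nonneg]
    have : 0 ≤ ρ * β / (2 * t * τ ^ 2) * (t - τ) ^ 2 := by positivity
    refine this.trans_eq ?_
    field_simp
    ring
  · refine (phiFn_le δ ρ τ β hlam hA hτ hb).trans ?_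
    have hP : ∫ h, h * Xval lam A τ β h ∂(gaussianReal 0 1) = τ * δ - β / 2 := by linarith
    rw [phiFn_eq δ ρ hlam hA hτ hβ, hS, hP, ← sub_nonneg]
    have : 0 ≤ (b - β) ^ 2 / 4 := by positivity
    refine this.trans_eq ?_
    field_simp
    ring

/-- the saddle point `(τ*, β*)` is the unique positive solution to the system
`τ²δ = ρ + E[X²]`, `β = 2τδ − 2E[H X]`, and at the saddle point
`φ(τ*, β*) = (β*)²/4 + λ E[X²]`. -/
theorem stmt1 (δ lam ρ A τs βs : ℝ) (hδ : 0 < δ) (hlam : 0 ≤ lam) (hρ : 0 < ρ) (hA : 0 < A)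
    (hcond : 0 < lam ∨ (lam = 0 ∧ 1 ≤ δ))
    (hsaddle : IsSaddle δ lam ρ A τs βs)
    (huniq : ∀ τ β : ℝ, IsSaddle δ lam ρ A τ β → τ = τs ∧ β = βs) :
    (∀ τ β : ℝ, 0 < τ → 0 < β →
      (((τ ^ 2 * δ = ρ + ∫ h : ℝ, (Xval lam A τ β h) ^ 2 ∂(gaussianReal 0 1)) ∧
          β = 2 * τ * δ - 2 * ∫ h : ℝ, h * Xval lam A τ β h ∂(gaussianReal 0 1)) ↔
        (τ = τs ∧ β = βs))) ∧
    phiFn δ lam ρ A τs βs =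
      βs ^ 2 / 4 + lam * ∫ h : ℝ, (Xval lam A τs βs h) ^ 2 ∂(gaussianReal 0 1) := by
  have h1 := hsaddle.tau_eq hδ hlam hρ hA
  have h2 := hsaddle.beta_eq hδ hlam hρ hA
  refine ⟨fun τ β hτ hβ => ⟨fun h => huniq τ β (isSaddle_of_system hlam hρ hA hτ hβ h.1 h.2), ?_⟩,
    ?_⟩
  · rintro ⟨rfl, rfl⟩
    exact ⟨h1, h2⟩
  · have hτ := hsaddle.1
    have hS := eq_sub_of_add_eq' h1.symm
    have hP : ∫ h, h * Xval lam A τs βs h ∂(gaussianReal 0 1) = τs * δ - βs / 2 := by linarith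
    rw [phiFn_eq δ ρ hlam hA hτ hsaddle.2.1, hS, hP]
    field_simp
    ring
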